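/- arXiv:1801.02795 — 3 statements merged into one kernel-verified Lean document; each statement's English description precedes it below -/
import Mathlib

section
/- Let m ≥ 0 and let s ∈ ℝ satisfy s ≥ ½ z²V. Then, setting Y = m·N₁ + N₂, one has Q(∇z, Y) − s·Q(∇τ, Y) ≥ (Σ_i p_i N₂^i)² + ½ m Σ_{A,B} h^{AB} p_A p_B + m c² ≥ 0. -/
open Matrix

/-- The "lower-index" metric matrix g = (g_{ij}) in Bondi–Sachs-type coordinates. -/
noncomputable def gLow (z V U2 U3 : ℝ) (h : Matrix (Fin 2) (Fin 2) ℝ) :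
    Matrix (Fin 4) (Fin 4) ℝ :=
  !![-z ^ 2 * V + (h 0 0 * U2 * U2 + h 0 1 * U2 * U3 + h 1 0 * U3 * U2 + h 1 1 * U3 * U3), 1,
        -(h 0 0 * U2 + h 0 1 * U3), -(h 1 0 * U2 + h 1 1 * U3);
      1, 0, 0, 0;
      -(h 0 0 * U2 + h 0 1 * U3), 0, h 0 0, h 0 1;
      -(h 1 0 * U2 + h 1 1 * U3), 0, h 1 0, h 1 1]

/-- The "upper-index" matrix ḡ = (g^{ij}), where k = (h^{AB}) is the inverse of (h_{AB}). -/
noncomputable def gUp (z V U2 U3 : ℝ) (k : Matrix (Fin 2) (Fin 2) ℝ) :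
    Matrix (Fin 4) (Fin 4) ℝ :=
  !![0, 1, 0, 0;
      1, z ^ 2 * V, U2, U3;
      0, U2, k 0 0, k 0 1;
      0, U3, k 1 0, k 1 1]

/-- The null vector N₁ = (0, −1, 0, 0). -/
noncomputable def N1 : Fin 4 → ℝ := ![0, -1, 0, 0]

/-- The null vector N₂ = (1, ½ z²V, U², U³). -/
noncomputable def N2 (z V U2 U3 : ℝ) : Fin 4 → ℝ := ![1, 1 / 2 * z ^ 2 * V, U2, U3]

/-- The gradient vector ∇τ = (0, 1, 0, 0). -/
noncomputable def gradTau : Fin 4 → ℝ := ![0, 1, 0, 0]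

/-- The gradient vector ∇z = (1, z²V, U², U³). -/
noncomputable def gradZ (z V U2 U3 : ℝ) : Fin 4 → ℝ := ![1, z ^ 2 * V, U2, U3]

/-- The energy–momentum form
`Q(X,Y) = (Σ p_i X^i)(Σ p_j Y^j) − ½ (Xᵀ g Y)(pᵀ ḡ p) − (Xᵀ g Y) c²`. -/
noncomputable def Qf (z V U2 U3 : ℝ) (h k : Matrix (Fin 2) (Fin 2) ℝ)
    (p : Fin 4 → ℝ) (c : ℝ) (X Y : Fin 4 → ℝ) : ℝ :=
  (p ⬝ᵥ X) * (p ⬝ᵥ Y)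
    - 1 / 2 * (X ⬝ᵥ (gLow z V U2 U3 h).mulVec Y) * (p ⬝ᵥ (gUp z V U2 U3 k).mulVec p)
    - (X ⬝ᵥ (gLow z V U2 U3 h).mulVec Y) * c ^ 2

/-- The quadratic form of a right inverse of a positive definite `2 × 2` matrix is nonnegative. -/
lemma quadForm_nonneg_of_posDef_mul_eq_one {h k : Matrix (Fin 2) (Fin 2) ℝ}
    (hpd : h.PosDef) (hk : h * k = 1) (x y : ℝ) :
    0 ≤ k 0 0 * x * x + k 0 1 * x * y + k 1 0 * y * x + k 1 1 * y * y := by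
  have hkpd : k.PosDef := Matrix.inv_eq_right_inv hk ▸ hpd.inv
  have hxy := hkpd.posSemidef.dotProduct_mulVec_nonneg ![x, y]
  simp [Matrix.mulVec, dotProduct, Fin.sum_univ_two] at hxy
  linarith

/-- The null decomposition of `Q(∇z, Y) - s Q(∇τ, Y)` for `Y = m N₁ + N₂`. -/
lemma Qf_gradZ_sub_smul_Qf_gradTau (z V U2 U3 : ℝ) {h : Matrix (Fin 2) (Fin 2) ℝ}
    (k : Matrix (Fin 2) (Fin 2) ℝ) (hsymm : h.IsSymm) (p : Fin 4 → ℝ) (c m s : ℝ) :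
    Qf z V U2 U3 h k p c (gradZ z V U2 U3) (m • N1 + N2 z V U2 U3)
        - s * Qf z V U2 U3 h k p c gradTau (m • N1 + N2 z V U2 U3)
      = (p ⬝ᵥ N2 z V U2 U3) ^ 2
        + 1 / 2 * m * (k 0 0 * p 2 * p 2 + k 0 1 * p 2 * p 3
            + k 1 0 * p 3 * p 2 + k 1 1 * p 3 * p 3)
        + m * c ^ 2
        + (s - 1 / 2 * z ^ 2 * V) * (m * p 1 ^ 2
          + 1 / 2 * (k 0 0 * p 2 * p 2 + k 0 1 * p 2 * p 3
            + k 1 0 * p 3 * p 2 + k 1 1 * p 3 * p 3) + c ^ 2) := by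
  have h10 : h 1 0 = h 0 1 := hsymm.apply 0 1
  simp only [Qf, gLow, gUp, N1, N2, gradZ, gradTau, Matrix.mulVec, dotProduct,
    Fin.sum_univ_four, Pi.add_apply, Pi.smul_apply, smul_eq_mul, Matrix.of_apply,
    Matrix.cons_val, h10]
  ring

/-- if m ≥ 0 and s ≥ ½ z²V, then for Y = m·N₁ + N₂,
Q(∇z, Y) − s·Q(∇τ, Y) ≥ (Σ p_i N₂^i)² + ½m Σ h^{AB} p_A p_B + m c² ≥ 0. -/
theorem stmt_9 (z V U2 U3 : ℝ) (h k : Matrix (Fin 2) (Fin 2) ℝ)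
    (hsymm : h.IsSymm) (hpd : h.PosDef) (hk : h * k = 1)
    (p : Fin 4 → ℝ) (c : ℝ) (m s : ℝ) (hm : 0 ≤ m) (hs : 1 / 2 * z ^ 2 * V ≤ s) :
    Qf z V U2 U3 h k p c (gradZ z V U2 U3) (m • N1 + N2 z V U2 U3)
        - s * Qf z V U2 U3 h k p c gradTau (m • N1 + N2 z V U2 U3)
      ≥ (p ⬝ᵥ N2 z V U2 U3) ^ 2
        + 1 / 2 * m * (k 0 0 * p 2 * p 2 + k 0 1 * p 2 * p 3
            + k 1 0 * p 3 * p 2 + k 1 1 * p 3 * p 3)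
        + m * c ^ 2 ∧
    (p ⬝ᵥ N2 z V U2 U3) ^ 2
        + 1 / 2 * m * (k 0 0 * p 2 * p 2 + k 0 1 * p 2 * p 3
            + k 1 0 * p 3 * p 2 + k 1 1 * p 3 * p 3)
        + m * c ^ 2 ≥ 0 := by
  have hquad := quadForm_nonneg_of_posDef_mul_eq_one hpd hk (p 2) (p 3)
  rw [Qf_gradZ_sub_smul_Qf_gradTau z V U2 U3 k hsymm]
  have hs' : 0 ≤ s - 1 / 2 * z ^ 2 * V := sub_nonneg.mpr hs
  exact ⟨le_add_of_nonneg_right (by positivity), by positivity⟩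
end

section
/- Let z₀ > 0, K ≥ 0, 0 < λ ≤ Λ. There exists m₀ > 0, depending only on z₀, K, λ, Λ, such that for every m ≥ m₀ there is a constant C > 0, depending only on m, z₀, K, λ, Λ, with the following property: whenever z = z₀, ½ ≤ V ≤ 3/2, λ·I₂ ≤ (h_{AB}) ≤ Λ·I₂ (as quadratic forms), and |U²|, |U³| ≤ K, then for all p ∈ ℝ⁴ and c ∈ ℝ, Q(∇z, m·N₁ + N₂) ≤ C ( p₀² + Σ_{A,B} h^{AB} p_A p_B + c² ) − p₁². -/
open Matrix

/-- If `k` is the inverse of a symmetric `h` with `0 ≤ h ≤ Λ`, then `|v|² ≤ Λ vᵀ k v`. -/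
lemma dotProduct_self_le_mul_inverse_form {n : Type*} [Fintype n] [DecidableEq n]
    {h k : Matrix n n ℝ} {L : ℝ} (hL : 0 < L) (hs : h.IsSymm) (hk : h * k = 1)
    (h0 : ∀ v, 0 ≤ v ⬝ᵥ h *ᵥ v) (hle : ∀ v, v ⬝ᵥ h *ᵥ v ≤ L * (v ⬝ᵥ v)) (v : n → ℝ) :
    v ⬝ᵥ v ≤ L * (v ⬝ᵥ k *ᵥ v) := by
  have hkv : h *ᵥ (k *ᵥ v) = v := by rw [mulVec_mulVec, hk, one_mulVec]
  have hsymm : (k *ᵥ v) ⬝ᵥ h *ᵥ v = v ⬝ᵥ v := by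
    rw [dotProduct_mulVec, ← mulVec_transpose, hs.eq, hkv]
  have hpos := h0 (L • (k *ᵥ v) - v)
  rw [mulVec_sub, mulVec_smul, hkv] at hpos
  simp only [sub_dotProduct, dotProduct_sub, smul_dotProduct, dotProduct_smul, smul_eq_mul,
    hsymm, dotProduct_comm (k *ᵥ v) v] at hpos
  have := hle v
  refine le_of_mul_le_mul_left ?_ hL
  linarith

/-- The form `Q(∇z, m N₁ + N₂)` written out, with `a = p₀ + U^A p_A`. -/
lemma Qf_gradZ_smul_N1_add_N2 (z V U2 U3 m c : ℝ) (h k : Matrix (Fin 2) (Fin 2) ℝ)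
    (p : Fin 4 → ℝ) :
    Qf z V U2 U3 h k p c (gradZ z V U2 U3) (m • N1 + N2 z V U2 U3) =
      (p 0 + (U2 * p 2 + U3 * p 3)) ^ 2
        + z ^ 2 * V * (p 0 + (U2 * p 2 + U3 * p 3)) * p 1
        - 1 / 2 * (m - z ^ 2 * V / 2) * (z ^ 2 * V) * p 1 ^ 2
        + (m - z ^ 2 * V / 2) * ((k 0 0 * p 2 * p 2 + k 0 1 * p 2 * p 3
            + k 1 0 * p 3 * p 2 + k 1 1 * p 3 * p 3) / 2 + c ^ 2) := by
  simp [Qf, gLow, gUp, gradZ, N1, N2, dotProduct, mulVec, Fin.sum_univ_four]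
  ring

/-- given z₀ > 0, K ≥ 0, 0 < λ ≤ Λ, there is m₀ > 0 (depending only on
z₀, K, λ, Λ) such that for every m ≥ m₀ there is C > 0 (depending only on m, z₀, K, λ, Λ)
such that whenever z = z₀, ½ ≤ V ≤ 3/2, λI₂ ≤ (h_{AB}) ≤ ΛI₂ and |U²|, |U³| ≤ K,
then for all p, c: Q(∇z, m·N₁ + N₂) ≤ C (p₀² + Σ h^{AB} p_A p_B + c²) − p₁². -/
theorem stmt_11 (z₀ K lam Lam : ℝ)
    (hz₀ : 0 < z₀) (hK : 0 ≤ K) (hlam : 0 < lam) (hlL : lam ≤ Lam) :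
    ∃ m₀ : ℝ, 0 < m₀ ∧
      ∀ m : ℝ, m₀ ≤ m →
        ∃ C : ℝ, 0 < C ∧
          ∀ (V U2 U3 : ℝ) (h k : Matrix (Fin 2) (Fin 2) ℝ),
            h.IsSymm → h.PosDef → h * k = 1 →
            1 / 2 ≤ V → V ≤ 3 / 2 →
            (∀ ξ : Fin 2 → ℝ, lam * (ξ ⬝ᵥ ξ) ≤ ξ ⬝ᵥ h.mulVec ξ
                ∧ ξ ⬝ᵥ h.mulVec ξ ≤ Lam * (ξ ⬝ᵥ ξ)) →
            |U2| ≤ K → |U3| ≤ K →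
            ∀ (p : Fin 4 → ℝ) (c : ℝ),
              Qf z₀ V U2 U3 h k p c (gradZ z₀ V U2 U3) (m • N1 + N2 z₀ V U2 U3)
                ≤ C * ((p 0) ^ 2
                    + (k 0 0 * p 2 * p 2 + k 0 1 * p 2 * p 3
                        + k 1 0 * p 3 * p 2 + k 1 1 * p 3 * p 3)
                    + c ^ 2)
                  - (p 1) ^ 2 := by
  have hz2 : 0 < z₀ ^ 2 := by positivity
  have hL : 0 < Lam := hlam.trans_le hlL
  refine ⟨3 / 4 * z₀ ^ 2 + 8 / z₀ ^ 2, by positivity, fun m hm => ?_⟩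
  have h8 : 0 < 8 / z₀ ^ 2 := by positivity
  have hm0 : 0 < m := by linarith
  refine ⟨(1 + z₀ ^ 4) * (2 + 4 * K ^ 2 * Lam) + m, by positivity, ?_⟩
  intro V U2 U3 h k hs _ hk hV1 hV2 hb hU2 hU3 p c
  have hform := dotProduct_self_le_mul_inverse_form hL hs hk
    (fun v => (mul_nonneg hlam.le (dotProduct_self_star_nonneg v)).trans (hb v).1)
    (fun v => (hb v).2) ![p 2, p 3]
  rw [Qf_gradZ_smul_N1_add_N2]
  obtain ⟨q, hq⟩ : ∃ q, k 0 0 * p 2 * p 2 + k 0 1 * p 2 * p 3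
      + k 1 0 * p 3 * p 2 + k 1 1 * p 3 * p 3 = q := ⟨_, rfl⟩
  have hpq : p 2 ^ 2 + p 3 ^ 2 ≤ Lam * q := by
    simp only [dotProduct, mulVec, Fin.sum_univ_two, cons_val_zero, cons_val_one] at hform
    rw [← hq]
    linarith
  rw [hq]
  have hq0 : 0 ≤ q := nonneg_of_mul_nonneg_right ((by positivity : (0 : ℝ) ≤ _).trans hpq) hL
  obtain ⟨u, hu⟩ : ∃ u, U2 * p 2 + U3 * p 3 = u := ⟨_, rfl⟩
  have hu2 : u ^ 2 ≤ 2 * K ^ 2 * (Lam * q) := by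
    have h2 : U2 ^ 2 ≤ K ^ 2 := sq_le_sq' (abs_le.mp hU2).1 (abs_le.mp hU2).2
    have h3 : U3 ^ 2 ≤ K ^ 2 := sq_le_sq' (abs_le.mp hU3).1 (abs_le.mp hU3).2
    calc u ^ 2 ≤ (U2 ^ 2 + U3 ^ 2) * (p 2 ^ 2 + p 3 ^ 2) := by
          rw [← hu]; linarith [sq_nonneg (U2 * p 3 - U3 * p 2)]
      _ ≤ (2 * K ^ 2) * (Lam * q) := by gcongr; linarith
  rw [hu]
  obtain ⟨W, hW⟩ : ∃ W, z₀ ^ 2 * V = W := ⟨_, rfl⟩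
  have hW1 : z₀ ^ 2 / 2 ≤ W := by rw [← hW]; nlinarith
  have hW2 : W ≤ 3 / 2 * z₀ ^ 2 := by rw [← hW]; nlinarith
  rw [hW]
  have hW4 : W ^ 2 / 4 ≤ z₀ ^ 4 := by nlinarith
  have hrW : 4 ≤ (m - W / 2) * W :=
    calc (4 : ℝ) = 8 / z₀ ^ 2 * (z₀ ^ 2 / 2) := by field_simp; norm_num
      _ ≤ (m - W / 2) * W := by gcongr <;> linarith
  have hp1 : 2 * p 1 ^ 2 ≤ 1 / 2 * (m - W / 2) * W * p 1 ^ 2 := by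
    gcongr; linarith
  have hcross : W * (p 0 + u) * p 1 ≤ p 1 ^ 2 + W ^ 2 / 4 * (p 0 + u) ^ 2 := by
    linarith [sq_nonneg (p 1 - W / 2 * (p 0 + u))]
  have ha : (1 + W ^ 2 / 4) * (p 0 + u) ^ 2
      ≤ (1 + z₀ ^ 4) * (2 * p 0 ^ 2 + 4 * K ^ 2 * Lam * q) := by
    gcongr
    linarith [sq_nonneg (p 0 - u)]
  have hr : (m - W / 2) * (q / 2 + c ^ 2) ≤ m * (q + c ^ 2) := by
    gcongr <;> linarith
  have hslack : 0 ≤ (1 + z₀ ^ 4) * (2 * (q + c ^ 2) + 4 * K ^ 2 * Lam * (p 0 ^ 2 + c ^ 2))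
      + m * p 0 ^ 2 := by positivity
  linarith
end

section
/- Suppose additionally that the coordinate function z = x¹ is positive on U. Let u : U → ℝ be C², set v = u/z, let ĝ = z²g (so that ĝ⁻¹ = z⁻²ḡ and det ĝ = z⁸ det g), define □_{ĝ} by the same coordinate formula with ĝ in place of g, and define □_g z = μ⁻¹ Σ_α ∂_α(μ ḡ^{α1}). Then the conformal identity □_g u = z³ □_{ĝ} v + v □_g z holds at every point of U. -/
/-- The partial derivative ∂_i f(x) of a function f : ℝ⁴ → ℝ. -/
noncomputable def pd (i : Fin 4) (f : (Fin 4 → ℝ) → ℝ) (x : Fin 4 → ℝ) : ℝ :=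
  fderiv ℝ f x (Pi.single i 1)

section Helpers

variable {E : Type*} [NormedAddCommGroup E] [NormedSpace ℝ E] {n : Type*} [Fintype n]
  [DecidableEq n] {A : E → Matrix n n ℝ} {x : E}

theorem DifferentiableAt.matrix_det
    (hA : ∀ i j, DifferentiableAt ℝ (fun y => A y i j) x) :
    DifferentiableAt ℝ (fun y => (A y).det) x := by
  simp only [Matrix.det_apply']
  fun_prop

theorem DifferentiableAt.matrix_adjugate
    (hA : ∀ i j, DifferentiableAt ℝ (fun y => A y i j) x) (i j : n) :
    DifferentiableAt ℝ (fun y => (A y).adjugate i j) x := by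
  simp only [Matrix.adjugate_apply]
  refine DifferentiableAt.matrix_det fun k l => ?_
  by_cases h : k = j
  · subst h
    simp
  · simpa [Matrix.updateRow_ne h] using hA k l

theorem DifferentiableAt.matrix_inv
    (hA : ∀ i j, DifferentiableAt ℝ (fun y => A y i j) x) (hdet : (A x).det ≠ 0) (i j : n) :
    DifferentiableAt ℝ (fun y => (A y)⁻¹ i j) x := by
  simp only [Matrix.inv_def, Matrix.smul_apply, Ring.inverse_eq_inv', smul_eq_mul]
  exact ((DifferentiableAt.matrix_det hA).inv hdet).mul (DifferentiableAt.matrix_adjugate hA i j)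

end Helpers

theorem pd_coord (i j : Fin 4) (x : Fin 4 → ℝ) :
    pd i (fun y => y j) x = if i = j then 1 else 0 := by
  have h : HasFDerivAt (fun y : Fin 4 → ℝ => y j)
      (ContinuousLinearMap.proj (R := ℝ) (φ := fun _ : Fin 4 => ℝ) j) x := hasFDerivAt_apply j x
  simp [pd, h.fderiv, Pi.single_apply, eq_comm]

theorem pd_mul {f h : (Fin 4 → ℝ) → ℝ} {x : Fin 4 → ℝ} (i : Fin 4)
    (hf : DifferentiableAt ℝ f x) (hh : DifferentiableAt ℝ h x) :
    pd i (fun y => f y * h y) x = f x * pd i h x + h x * pd i f x := by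
  simp [pd, fderiv_fun_mul hf hh]

theorem pd_sub {f h : (Fin 4 → ℝ) → ℝ} {x : Fin 4 → ℝ} (i : Fin 4)
    (hf : DifferentiableAt ℝ f x) (hh : DifferentiableAt ℝ h x) :
    pd i (fun y => f y - h y) x = pd i f x - pd i h x := by
  simp [pd, fderiv_fun_sub hf hh]

theorem pd_congr {f h : (Fin 4 → ℝ) → ℝ} {U : Set (Fin 4 → ℝ)} (hU : IsOpen U)
    {x : Fin 4 → ℝ} (hx : x ∈ U) (hfh : ∀ y ∈ U, f y = h y) (i : Fin 4) :
    pd i f x = pd i h x := by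
  have : f =ᶠ[nhds x] h := Filter.eventually_of_mem (hU.mem_nhds hx) hfh
  rw [pd, pd, this.fderiv_eq]

theorem differentiableAt_pd {u : (Fin 4 → ℝ) → ℝ} {x : Fin 4 → ℝ} (hu : ContDiffAt ℝ 2 u x)
    (i : Fin 4) : DifferentiableAt ℝ (pd i u) x := by
  have h : DifferentiableAt ℝ (fderiv ℝ u) x :=
    (hu.fderiv_right (m := 1) (by norm_num)).differentiableAt (by norm_num)
  exact h.clm_apply (differentiableAt_const _)

theorem coord_mul_pd_div_coord {u : (Fin 4 → ℝ) → ℝ} {x : Fin 4 → ℝ} {j : Fin 4}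
    (hu : DifferentiableAt ℝ u x) (hx : x j ≠ 0) (i : Fin 4) :
    x j * pd i (fun y => u y / y j) x = pd i u x - u x / x j * if i = j then 1 else 0 := by
  have hz : DifferentiableAt ℝ (fun y : Fin 4 → ℝ => y j) x := differentiableAt_apply j x
  have hv : DifferentiableAt ℝ (fun y => u y / y j) x := by fun_prop (disch := assumption)
  have hev : u =ᶠ[nhds x] fun y => y j * (u y / y j) := by
    filter_upwards [hz.continuousAt.eventually_ne hx] with y hy
    field_simp
  have h : pd i u x = pd i (fun y => y j * (u y / y j)) x := by
    rw [pd, hev.fderiv_eq, pd]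
  rw [h, pd_mul i hz hv, pd_coord]
  ring


/-- if the coordinate z = x¹ is positive on U, u is C², v = u/z,
ĝ = z²g, and □_g z = μ⁻¹ Σ_α ∂_α(μ ḡ^{α1}), then the conformal identity
□_g u = z³ □_{ĝ} v + v □_g z holds at every point of U. -/
theorem stmt_17
    (U : Set (Fin 4 → ℝ)) (hU : IsOpen U)
    (g : (Fin 4 → ℝ) → Matrix (Fin 4) (Fin 4) ℝ)
    (hgsymm : ∀ x ∈ U, (g x).IsSymm)
    (hgC1 : ∀ i j : Fin 4, ContDiffOn ℝ 1 (fun x => g x i j) U)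
    (hgdet : ∀ x ∈ U, (g x).det < 0)
    (hzpos : ∀ x ∈ U, 0 < x 1)
    (gbar : (Fin 4 → ℝ) → Matrix (Fin 4) (Fin 4) ℝ)
    (hgbar : ∀ x ∈ U, gbar x = (g x)⁻¹)
    (μ : (Fin 4 → ℝ) → ℝ)
    (hμ : ∀ x, μ x = Real.sqrt (-(g x).det))
    (u : (Fin 4 → ℝ) → ℝ) (hu : ContDiffOn ℝ 2 u U)
    (v : (Fin 4 → ℝ) → ℝ) (hv : ∀ x, v x = u x / x 1)
    (ghat : (Fin 4 → ℝ) → Matrix (Fin 4) (Fin 4) ℝ)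
    (hghat : ∀ x, ghat x = (x 1) ^ 2 • g x)
    (ghatinv : (Fin 4 → ℝ) → Matrix (Fin 4) (Fin 4) ℝ)
    (hghatinv : ∀ x ∈ U, ghatinv x = (ghat x)⁻¹)
    (μhat : (Fin 4 → ℝ) → ℝ)
    (hμhat : ∀ x, μhat x = Real.sqrt (-(ghat x).det)) :
    ∀ x ∈ U,
      (μ x)⁻¹ * ∑ α : Fin 4, pd α (fun y => μ y * ∑ β : Fin 4, gbar y α β * pd β u y) x
        = (x 1) ^ 3 *
            ((μhat x)⁻¹ *
              ∑ α : Fin 4, pd α (fun y => μhat y * ∑ β : Fin 4, ghatinv y α β * pd β v y) x)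
          + v x * ((μ x)⁻¹ * ∑ α : Fin 4, pd α (fun y => μ y * gbar y α 1) x) := by
  intro x hx
  obtain rfl : v = fun y => u y / y 1 := funext hv
  have hcd (y) (hy : y ∈ U) : ContDiffAt ℝ 2 u y := hu.contDiffAt (hU.mem_nhds hy)
  have hud (y) (hy : y ∈ U) : DifferentiableAt ℝ u y := (hcd y hy).differentiableAt (by norm_num)
  have hgd (i j : Fin 4) : DifferentiableAt ℝ (fun y => g y i j) x :=
    ((hgC1 i j).contDiffAt (hU.mem_nhds hx)).differentiableAt (by norm_num)
  have hμhat_eq (y) (hy : y ∈ U) : μhat y = y 1 ^ 4 * μ y := by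
    have hz := hzpos y hy
    rw [hμhat, hμ, hghat, Matrix.det_smul, Fintype.card_fin,
      show -((y 1 ^ 2) ^ 4 * (g y).det) = (y 1 ^ 4) ^ 2 * -(g y).det by ring,
      Real.sqrt_mul (by positivity), Real.sqrt_sq (by positivity)]
  have hinv_eq (y) (hy : y ∈ U) (i j : Fin 4) :
      ghatinv y i j = (y 1 ^ 2)⁻¹ * gbar y i j := by
    have hz := hzpos y hy
    have hzu : IsUnit (y 1 ^ 2) := (pow_pos hz 2).ne'.isUnit
    have h := Matrix.inv_smul' (A := g y) hzu.unit (hgdet y hy).ne.isUnit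
    rw [hghatinv y hy, hghat, hgbar y hy]
    have h' : (y 1 ^ 2 • g y)⁻¹ = (y 1 ^ 2)⁻¹ • (g y)⁻¹ := by
      simpa [Units.smul_def] using h
    rw [h', Matrix.smul_apply, smul_eq_mul]
  have hgbar_symm (y) (hy : y ∈ U) (i j : Fin 4) : gbar y i j = gbar y j i := by
    rw [hgbar y hy]
    exact Matrix.IsSymm.apply (hgsymm y hy).inv j i
  have hμ_pos : 0 < μ x := by
    rw [hμ]
    exact Real.sqrt_pos.2 (by linarith [hgdet x hx])
  have hμd : DifferentiableAt ℝ μ x := by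
    rw [funext hμ]
    exact (DifferentiableAt.matrix_det hgd).neg.sqrt (neg_pos.2 (hgdet x hx)).ne'
  have hgbard (i j : Fin 4) : DifferentiableAt ℝ (fun y => gbar y i j) x :=
    (DifferentiableAt.matrix_inv hgd (hgdet x hx).ne i j).congr_of_eventuallyEq
      (Filter.eventually_of_mem (hU.mem_nhds hx) fun y hy => congrFun (congrFun (hgbar y hy) i) j)
  have hpd (i : Fin 4) := differentiableAt_pd (hcd x hx) i
  have hF (α : Fin 4) :
      DifferentiableAt ℝ (fun y => μ y * ∑ β : Fin 4, gbar y α β * pd β u y) x := by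
    fun_prop
  have hG (α : Fin 4) : DifferentiableAt ℝ (fun y => μ y * gbar y α 1) x := by
    fun_prop
  have hz : DifferentiableAt ℝ (fun y : Fin 4 → ℝ => y 1) x := differentiableAt_apply 1 x
  have hflux (α : Fin 4) (y) (hy : y ∈ U) :
      μhat y * ∑ β : Fin 4, ghatinv y α β * pd β (fun y => u y / y 1) y
        = y 1 * (μ y * ∑ β : Fin 4, gbar y α β * pd β u y) - u y * (μ y * gbar y α 1) := by
    have hy1 := (hzpos y hy).ne'
    have hpdv (β : Fin 4) : pd β (fun y => u y / y 1) y
        = (pd β u y - u y / y 1 * if β = 1 then 1 else 0) / y 1 := by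
      rw [← coord_mul_pd_div_coord (hud y hy) hy1 β]
      field_simp
    simp only [hμhat_eq y hy, hinv_eq y hy, hpdv, Fin.sum_univ_four]
    simp
    field_simp
    ring
  have hdiv (α : Fin 4) :
      pd α (fun y => μhat y * ∑ β : Fin 4, ghatinv y α β * pd β (fun y => u y / y 1) y) x
        = x 1 * pd α (fun y => μ y * ∑ β : Fin 4, gbar y α β * pd β u y) x
          + (μ x * ∑ β : Fin 4, gbar x α β * pd β u x) * (if α = 1 then 1 else 0)
          - (u x * pd α (fun y => μ y * gbar y α 1) x + μ x * gbar x α 1 * pd α u x) := by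
    rw [pd_congr hU hx (hflux α) α, pd_sub α (hz.fun_mul (hF α)) ((hud x hx).fun_mul (hG α)),
      pd_mul α hz (hF α), pd_mul α (hud x hx) (hG α), pd_coord]
  have hx1 := (hzpos x hx).ne'
  have hμ0 := hμ_pos.ne'
  have hcancel : ∑ α : Fin 4,
      ((μ x * ∑ β : Fin 4, gbar x α β * pd β u x) * (if α = 1 then 1 else 0)
        - μ x * gbar x α 1 * pd α u x) = 0 := by
    simp only [Finset.sum_sub_distrib, mul_ite, mul_one, mul_zero, Finset.sum_ite_eq',
      Finset.mem_univ, if_true, Finset.mul_sum]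
    rw [sub_eq_zero]
    exact Finset.sum_congr rfl fun β _ => by rw [hgbar_symm x hx 1 β, mul_assoc]
  have hsum : ∑ α : Fin 4,
      pd α (fun y => μhat y * ∑ β : Fin 4, ghatinv y α β * pd β (fun y => u y / y 1) y) x
        = x 1 * ∑ α : Fin 4, pd α (fun y => μ y * ∑ β : Fin 4, gbar y α β * pd β u y) x
          - u x * ∑ α : Fin 4, pd α (fun y => μ y * gbar y α 1) x := by
    rw [Finset.mul_sum, Finset.mul_sum, ← Finset.sum_sub_distrib, ← sub_eq_zero,
      ← Finset.sum_sub_distrib, ← hcancel]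
    exact Finset.sum_congr rfl fun α _ => by rw [hdiv α]; ring
  rw [hsum, hμhat_eq x hx]
  field_simp
  ring
end
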